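/- Let ψ be a cylinder function, t ≥ 0 with P(t) = 0, and let μ be an ergodic t-equilibrium measure. Then dim_ψ(μ) = t, where dim_ψ(μ) = inf{ dim_ψ(A) : A Borel, μ(A) = 1 }. -/

import Mathlib

open Filter Topology MeasureTheory

/-- The cylinder set `[w] ⊆ I^∞` determined by a finite word `w`. -/
def cyl {I : Type*} (w : List I) : Set (ℕ → I) :=
  {x | ∀ k : Fin w.length, x k = w.get k}

/-- The left shift `σ : I^∞ → I^∞`. -/
def shift {I : Type*} (x : ℕ → I) : ℕ → I := fun n => x (n + 1)

/-- The concatenation `w,x ∈ I^∞` of a finite word `w` with an infinite word `x`. -/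
def wcat {I : Type*} (w : List I) (x : ℕ → I) : ℕ → I := fun n =>
  if h : n < w.length then w.get ⟨n, h⟩ else x (n - w.length)

/-- The word `x|_n` consisting of the first `n` letters of `x ∈ I^∞`. -/
def pref {I : Type*} (x : ℕ → I) (n : ℕ) : List I := List.ofFn (fun k : Fin n => x k)

/-- A *cylinder function*: a family `ψ t w : I^∞ → (0,∞)` for `t ≥ 0` and nonempty words `w`,
satisfying the bounded variation principle (with constant `K t ≥ 1`), the subchain rule, and
comparability in the parameter `t` with constants `0 < slo, shi < 1`. -/
structure CylFun (I : Type*) where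
  ψ : ℝ → List I → (ℕ → I) → ℝ
  K : ℝ → ℝ
  slo : ℝ
  shi : ℝ
  pos : ∀ t : ℝ, 0 ≤ t → ∀ w : List I, w ≠ [] → ∀ h : ℕ → I, 0 < ψ t w h
  one_le_K : ∀ t : ℝ, 0 ≤ t → 1 ≤ K t
  bvp : ∀ t : ℝ, 0 ≤ t → ∀ w : List I, w ≠ [] → ∀ h j : ℕ → I, ψ t w h ≤ K t * ψ t w j
  subchain : ∀ t : ℝ, 0 ≤ t → ∀ w : List I, ∀ j : ℕ, 1 ≤ j → j < w.length → ∀ h : ℕ → I,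
    ψ t w h ≤ ψ t (w.take j) (wcat (w.drop j) h) * ψ t (w.drop j) h
  slo_pos : 0 < slo
  slo_lt_one : slo < 1
  shi_pos : 0 < shi
  shi_lt_one : shi < 1
  le_param : ∀ t : ℝ, 0 ≤ t → ∀ δ : ℝ, 0 ≤ δ → ∀ w : List I, w ≠ [] → ∀ h : ℕ → I,
    ψ t w h * slo ^ (δ * (w.length : ℝ)) ≤ ψ (t + δ) w h
  param_le : ∀ t : ℝ, 0 ≤ t → ∀ δ : ℝ, 0 ≤ δ → ∀ w : List I, w ≠ [] → ∀ h : ℕ → I,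
    ψ (t + δ) w h ≤ ψ t w h * shi ^ (δ * (w.length : ℝ))

/-- A Borel probability measure on `I^∞` is (shift-)invariant if `μ [w] = μ (σ⁻¹ [w])`
for every finite word `w`. -/
def IsShiftInvariant {I : Type*} [MeasurableSpace I] (μ : Measure (ℕ → I)) : Prop :=
  ∀ w : List I, w ≠ [] → μ (cyl w) = μ (shift ⁻¹' cyl w)

/-- A measure on `I^∞` is ergodic if every Borel set `A` with `σ⁻¹ A = A` is null or conull. -/
def IsShiftErgodic {I : Type*} [MeasurableSpace I] (μ : Measure (ℕ → I)) : Prop :=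
  ∀ A : Set (ℕ → I), MeasurableSet A → shift ⁻¹' A = A → μ A = 0 ∨ μ A = 1

section seqs

variable {I : Type*} [Fintype I] [MeasurableSpace I]

/-- `(1/n) log ∑_{i ∈ Iⁿ} ψᵢᵗ(h)`: the sequence defining the topological pressure `P(t)`. -/
noncomputable def presSeq (C : CylFun I) (t : ℝ) (h : ℕ → I) (n : ℕ) : ℝ :=
  (n : ℝ)⁻¹ * Real.log (∑ f : Fin n → I, C.ψ t (List.ofFn f) h)

/-- `-(1/n) ∑_{i ∈ Iⁿ} μ[i] log μ[i]`: the sequence defining the entropy `h_μ`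
(with the convention `0 · log 0 = 0`, automatic since `Real.log 0 = 0`). -/
noncomputable def entSeq (μ : Measure (ℕ → I)) (n : ℕ) : ℝ :=
  -((n : ℝ)⁻¹ * ∑ f : Fin n → I,
      (μ (cyl (List.ofFn f))).toReal * Real.log (μ (cyl (List.ofFn f))).toReal)

/-- `(1/n) ∑_{i ∈ Iⁿ} μ[i] log ψᵢᵗ(h)`: the sequence defining the energy `E_μ(t)`. -/
noncomputable def enSeq (μ : Measure (ℕ → I)) (C : CylFun I) (t : ℝ) (h : ℕ → I) (n : ℕ) : ℝ :=
  (n : ℝ)⁻¹ * ∑ f : Fin n → I,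
    (μ (cyl (List.ofFn f))).toReal * Real.log (C.ψ t (List.ofFn f) h)

end seqs

section dim

variable {I : Type*}

open scoped ENNReal

/-- The pre-measure `G_n^t(A)`: infimum of `∑_j ψ_{i_j}^t(h)` over countable covers of `A`
by cylinders of level at least `n`. -/
noncomputable def Gpre (C : CylFun I) (t : ℝ) (h : ℕ → I) (n : ℕ) (A : Set (ℕ → I)) : ℝ≥0∞ :=
  ⨅ (c : ℕ → List I) (_ : A ⊆ ⋃ j : ℕ, cyl (c j)) (_ : ∀ j : ℕ, n ≤ (c j).length),
    ∑' j : ℕ, ENNReal.ofReal (C.ψ t (c j) h)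

/-- The measure `G^t(A) = lim_{n→∞} G_n^t(A)` from Carathéodory's construction. -/
noncomputable def Gmeas (C : CylFun I) (t : ℝ) (h : ℕ → I) (A : Set (ℕ → I)) : ℝ≥0∞ :=
  ⨆ n : ℕ, Gpre C t h n A

/-- The equilibrium dimension `dim_ψ(A) = inf { t ≥ 0 : G^t(A) = 0 }`. -/
noncomputable def eqDim (C : CylFun I) (h : ℕ → I) (A : Set (ℕ → I)) : ℝ :=
  sInf {t : ℝ | 0 ≤ t ∧ Gmeas C t h A = 0}

end dim

section words

variable {I : Type*} [Fintype I]

/-- The sum of `F` over all words of length `n`. -/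
def wordSum (n : ℕ) (F : List I → ℝ) : ℝ := ∑ f : Fin n → I, F (List.ofFn f)

lemma wordSum_zero (F : List I → ℝ) : wordSum 0 F = F [] := by
  simp [wordSum]

lemma wordSum_succ (n : ℕ) (F : List I → ℝ) :
    wordSum (n + 1) F = ∑ a, wordSum n (fun u => F (a :: u)) := by
  unfold wordSum
  rw [← Fintype.sum_prod_type']
  refine (Fintype.sum_equiv (Fin.consEquiv (fun _ => I)) _ _ fun x => ?_).symm
  simp [Fin.consEquiv]

lemma wordSum_congr {n : ℕ} {F G : List I → ℝ} (hFG : ∀ u, u.length = n → F u = G u) :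
    wordSum n F = wordSum n G :=
  Finset.sum_congr rfl fun f _ => hFG _ (by simp)

lemma wordSum_mono {n : ℕ} {F G : List I → ℝ} (hFG : ∀ u, u.length = n → F u ≤ G u) :
    wordSum n F ≤ wordSum n G :=
  Finset.sum_le_sum fun f _ => hFG _ (by simp)

lemma wordSum_add (n : ℕ) (F G : List I → ℝ) :
    wordSum n (fun u => F u + G u) = wordSum n F + wordSum n G :=
  Finset.sum_add_distrib

lemma wordSum_mul_left (n : ℕ) (c : ℝ) (F : List I → ℝ) :
    wordSum n (fun u => c * F u) = c * wordSum n F :=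
  (Finset.mul_sum _ _ _).symm

lemma wordSum_finset_sum {ι : Type*} (n : ℕ) (s : Finset ι) (F : ι → List I → ℝ) :
    wordSum n (fun u => ∑ i ∈ s, F i u) = ∑ i ∈ s, wordSum n (F i) :=
  Finset.sum_comm

open Classical in
lemma wordSum_prefix (w : List I) (n : ℕ) (F : List I → ℝ) :
    wordSum n (fun u => if w <+: u then F u else 0) =
      if w.length ≤ n then wordSum (n - w.length) (fun v => F (w ++ v)) else 0 := by
  induction w generalizing n F with
  | nil => simp
  | cons a w ih =>
    cases n with
    | zero => simp [wordSum_zero]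
    | succ n =>
      rw [wordSum_succ, Finset.sum_eq_single a]
      · simpa using ih n (fun u => F (a :: u))
      · intro b _ hb
        simp [List.cons_prefix_cons, hb.symm, wordSum]
      · simp

end words

section badCount

variable {I : Type*}

open Classical in
/-- The number of positions of the word at which no word of `S` starts. -/
noncomputable def badCount (S : Set (List I)) : List I → ℕ
  | [] => 0
  | a :: v => badCount S v + if ∃ w ∈ S, w <+: a :: v then 0 else 1

lemma badCount_append_le (S : Set (List I)) (w v : List I) :
    badCount S v ≤ badCount S (w ++ v) := by
  induction w with
  | nil => simp
  | cons a w ih => simp only [List.cons_append, badCount]; omega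

variable [Fintype I]

/-- A Kraft-type inequality: if the submultiplicative weight `g` is small on `S` and on the
letters after discounting by `r`, then the discounted weights of the words of given length sum
to at most one. -/
lemma wordSum_discounted_le_one {g : List I → ℝ} {K r : ℝ} (hg : ∀ u, 0 ≤ g u)
    (hg_nil : g [] = 1) (hgK : ∀ u v, g (u ++ v) ≤ K * g u * g v) (hK : 0 ≤ K)
    (hr : 0 ≤ r) (hr1 : r ≤ 1) (S : Finset (List I)) (hS : ∀ w ∈ S, w ≠ [])
    (hSsum : ∑ w ∈ S, K * g w ≤ 1 / 2) (hletter : ∑ a : I, K * g [a] * r ≤ 1 / 2) (n : ℕ) :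
    wordSum n (fun u => g u * r ^ badCount (S : Set (List I)) u) ≤ 1 := by
  classical
  set q : List I → ℝ := fun u => g u * r ^ badCount (S : Set (List I)) u with hq
  have hq0 : ∀ u, 0 ≤ q u := fun u => mul_nonneg (hg u) (pow_nonneg hr _)
  have hqapp : ∀ u v, q (u ++ v) ≤ K * g u * q v := fun u v => by
    simp only [hq]
    rw [← mul_assoc]
    exact mul_le_mul (hgK u v) (pow_le_pow_of_le_one hr hr1 (badCount_append_le _ u v))
      (pow_nonneg hr _) (mul_nonneg (mul_nonneg hK (hg u)) (hg v))
  induction n using Nat.strong_induction_on with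
  | _ n ih =>
    cases n with
    | zero => simp [wordSum_zero, hq, hg_nil, badCount]
    | succ n =>
      have hsplit : wordSum (n + 1) q ≤
          wordSum (n + 1) (fun u => ∑ w ∈ S, if w <+: u then q u else 0) +
            wordSum (n + 1) (fun u => if ∃ w ∈ S, w <+: u then 0 else q u) := by
        rw [← wordSum_add]
        refine wordSum_mono fun u _ => ?_
        have hnn : ∀ w ∈ S, 0 ≤ if w <+: u then q u else 0 := fun w _ => by
          split_ifs
          exacts [hq0 u, le_rfl]
        by_cases hu : ∃ w ∈ S, w <+: u
        · obtain ⟨w, hw, hwu⟩ := hu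
          rw [if_pos ⟨w, hw, hwu⟩, add_zero]
          simpa [hwu] using Finset.single_le_sum hnn hw
        · rw [if_neg hu]
          have := Finset.sum_nonneg hnn
          linarith
      have hgood : wordSum (n + 1) (fun u => ∑ w ∈ S, if w <+: u then q u else 0) ≤ 1 / 2 := by
        rw [wordSum_finset_sum]
        refine le_trans (Finset.sum_le_sum fun w hw => ?_) hSsum
        rw [wordSum_prefix]
        have hKg : 0 ≤ K * g w := mul_nonneg hK (hg w)
        split_ifs with hlen
        · have hpos : 0 < w.length := List.length_pos_of_ne_nil (hS w hw)
          calc wordSum (n + 1 - w.length) (fun v => q (w ++ v))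
              ≤ wordSum (n + 1 - w.length) (fun v => K * g w * q v) :=
                wordSum_mono fun v _ => hqapp w v
            _ = K * g w * wordSum (n + 1 - w.length) q := wordSum_mul_left _ _ _
            _ ≤ K * g w * 1 := mul_le_mul_of_nonneg_left (ih _ (by omega)) hKg
            _ = K * g w := mul_one _
        · exact hKg
      have hbad : wordSum (n + 1) (fun u => if ∃ w ∈ S, w <+: u then 0 else q u) ≤ 1 / 2 := by
        rw [wordSum_succ]
        refine le_trans (Finset.sum_le_sum fun a _ => ?_) hletter
        have hKg : 0 ≤ K * g [a] * r := mul_nonneg (mul_nonneg hK (hg _)) hr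
        calc wordSum n (fun v => if ∃ w ∈ S, w <+: a :: v then 0 else q (a :: v))
            ≤ wordSum n (fun v => K * g [a] * r * q v) := by
              refine wordSum_mono fun v _ => ?_
              split_ifs with hav
              · exact mul_nonneg hKg (hq0 v)
              · have h1 : badCount (S : Set (List I)) (a :: v) =
                    badCount (S : Set (List I)) v + 1 := by
                  have hav' : ¬ ∃ w ∈ (S : Set (List I)), w <+: a :: v := by simpa using hav
                  simp only [badCount]
                  rw [if_neg hav']
                simp only [hq, h1]
                have h2 := mul_le_mul_of_nonneg_right (hgK [a] v)
                  (pow_nonneg hr (badCount (S : Set (List I)) v + 1))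
                refine h2.trans (le_of_eq ?_)
                rw [pow_succ]; ring
          _ = K * g [a] * r * wordSum n q := wordSum_mul_left _ _ _
          _ ≤ K * g [a] * r * 1 := mul_le_mul_of_nonneg_left (ih n (by omega)) hKg
          _ = K * g [a] * r := mul_one _
      linarith

end badCount

section measure

variable {I : Type*}

lemma cyl_cons (a : I) (w : List I) : cyl (a :: w) = {x | x 0 = a ∧ shift x ∈ cyl w} := by
  ext x
  simp only [cyl, Set.mem_ofPred_eq, shift, List.length_cons]
  constructor
  · intro hx
    refine ⟨hx 0, fun k => ?_⟩
    simpa using hx k.succ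
  · rintro ⟨h0, h1⟩ k
    refine Fin.cases ?_ (fun k => ?_) k
    · simpa using h0
    · simpa using h1 k

lemma mem_cyl_ofFn {n : ℕ} {f : Fin n → I} {x : ℕ → I} :
    x ∈ cyl (List.ofFn f) ↔ ∀ k : Fin n, x k = f k := by
  constructor
  · intro hx k
    simpa using hx (k.cast (by simp))
  · intro hx k
    have := hx (k.cast (by simp))
    simp only [List.get_eq_getElem, List.getElem_ofFn]
    exact this

lemma mem_cyl_pref (x : ℕ → I) (n : ℕ) : x ∈ cyl (pref x n) :=
  mem_cyl_ofFn.2 fun _ => rfl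

lemma isPrefix_of_mem_cyl {u w : List I} {x : ℕ → I} (hu : x ∈ cyl u) (hw : x ∈ cyl w)
    (hlen : w.length ≤ u.length) : w <+: u := by
  rw [List.prefix_iff_eq_take]
  refine List.ext_getElem (by simpa using hlen) fun i hi hi' => ?_
  have h1 := hu ⟨i, by omega⟩
  have h2 := hw ⟨i, hi⟩
  simp only [List.get_eq_getElem] at h1 h2
  simp [← h1, ← h2]

variable [MeasurableSpace I] [DiscreteMeasurableSpace I]

lemma measurableSet_cyl (w : List I) : MeasurableSet (cyl w) := by
  rw [cyl, Set.ofPred_forall]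
  exact MeasurableSet.iInter fun k =>
    (measurable_pi_apply (X := fun _ : ℕ => I) (k : ℕ))
      (MeasurableSet.of_discrete (s := {w.get k}))

variable [Fintype I] (μ : Measure (ℕ → I)) [IsProbabilityMeasure μ]

lemma sum_measureReal_cyl_cons (hinv : IsShiftInvariant μ) (w : List I) :
    ∑ a, μ.real (cyl (a :: w)) = μ.real (cyl w) := by
  have hpre : μ.real (cyl w) = μ.real (shift ⁻¹' cyl w) := by
    by_cases hw : w = []
    · subst hw
      simp [cyl]
    · simp only [Measure.real, hinv w hw]
  have hU : shift ⁻¹' cyl w = ⋃ a, cyl (a :: w) := by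
    ext x
    simp [cyl_cons]
  rw [hpre, hU, measureReal_iUnion_fintype]
  · intro a b hab
    refine Set.disjoint_left.2 fun x hx hx' => hab ?_
    simp only [cyl_cons] at hx hx'
    exact hx.1.symm.trans hx'.1
  · exact fun a => measurableSet_cyl _

lemma wordSum_measureReal_cyl (hinv : IsShiftInvariant μ) (n : ℕ) :
    wordSum n (fun u => μ.real (cyl u)) = 1 := by
  induction n with
  | zero => simp [wordSum_zero, cyl]
  | succ n ih =>
    rw [wordSum_succ, ← wordSum_finset_sum, ← ih]
    exact wordSum_congr fun u _ => sum_measureReal_cyl_cons μ hinv u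

open Classical in
lemma wordSum_bad_le (S : Finset (List I)) {L n : ℕ} (hL : ∀ w ∈ S, w.length ≤ L)
    (hn : L ≤ n) :
    wordSum n (fun u => if ∃ w ∈ S, w <+: u then 0 else μ.real (cyl u)) ≤
      μ.real (⋃ w ∈ S, cyl w)ᶜ := by
  set T : Finset (Fin n → I) :=
    Finset.univ.filter fun f => ¬ ∃ w ∈ S, w <+: List.ofFn f with hT
  have h1 : wordSum n (fun u => if ∃ w ∈ S, w <+: u then 0 else μ.real (cyl u)) =
      ∑ f ∈ T, μ.real (cyl (List.ofFn f)) := by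
    rw [wordSum, hT, Finset.sum_filter]
    exact Finset.sum_congr rfl fun f _ => by split_ifs <;> simp_all
  rw [h1, ← measureReal_biUnion_finset]
  · refine measureReal_mono ?_
    intro x hx
    simp only [Set.mem_iUnion, hT, Finset.mem_filter, exists_prop] at hx
    obtain ⟨f, ⟨-, hf⟩, hxf⟩ := hx
    simp only [Set.mem_compl_iff, Set.mem_iUnion, not_exists]
    intro w hw hxw
    exact hf ⟨w, hw, isPrefix_of_mem_cyl hxf hxw (by simpa using (hL w hw).trans hn)⟩
  · intro f _ f' _ hff
    refine Set.disjoint_left.2 fun x hx hx' => hff ?_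
    ext k
    rw [← mem_cyl_ofFn.1 hx k, ← mem_cyl_ofFn.1 hx' k]
  · exact fun f _ => measurableSet_cyl _

lemma wordSum_badCount_le (hinv : IsShiftInvariant μ) (S : Finset (List I)) {L : ℕ}
    (hL : ∀ w ∈ S, w.length ≤ L) (n : ℕ) :
    wordSum n (fun u => μ.real (cyl u) * badCount (S : Set (List I)) u) ≤
      n * μ.real (⋃ w ∈ S, cyl w)ᶜ + L := by
  classical
  set ε := μ.real (⋃ w ∈ S, cyl w)ᶜ
  have hε : 0 ≤ ε := measureReal_nonneg
  have hstep : ∀ n, wordSum (n + 1) (fun u => μ.real (cyl u) * badCount (S : Set (List I)) u) =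
      wordSum n (fun u => μ.real (cyl u) * badCount (S : Set (List I)) u) +
        wordSum (n + 1) (fun u => if ∃ w ∈ S, w <+: u then 0 else μ.real (cyl u)) := by
    intro n
    rw [wordSum_succ, wordSum_succ, ← wordSum_finset_sum, ← wordSum_finset_sum, ← wordSum_add]
    refine wordSum_congr fun u _ => ?_
    rw [← sum_measureReal_cyl_cons μ hinv u, Finset.sum_mul, ← Finset.sum_add_distrib]
    refine Finset.sum_congr rfl fun a _ => ?_
    simp only [badCount, Finset.mem_coe]
    split_ifs <;> push_cast <;> ring
  have hmin : wordSum n (fun u => μ.real (cyl u) * badCount (S : Set (List I)) u) ≤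
      n * ε + min (n : ℝ) L := by
    induction n with
    | zero => simp [wordSum_zero, badCount]
    | succ n ih =>
      rw [hstep]
      by_cases hn : L ≤ n + 1
      · have := wordSum_bad_le μ S hL hn
        have hm : min (n : ℝ) L ≤ min ((n + 1 : ℕ) : ℝ) L :=
          min_le_min_right _ (by push_cast; linarith)
        push_cast at hm ⊢
        linarith
      · have hle : wordSum (n + 1) (fun u => if ∃ w ∈ S, w <+: u then 0 else μ.real (cyl u)) ≤
            1 := by
          rw [← wordSum_measureReal_cyl μ hinv (n + 1)]
          refine wordSum_mono fun u _ => ?_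
          split_ifs
          exacts [measureReal_nonneg, le_rfl]
        have hnL : ((n + 1 : ℕ) : ℝ) ≤ L := by exact_mod_cast (not_le.1 hn).le
        rw [min_eq_left hnL]
        have hm : min (n : ℝ) L ≤ n := min_le_left _ _
        push_cast
        linarith
  exact hmin.trans (by gcongr; exact min_le_right _ _)

/-- Gibbs' inequality for the discounted weights `g u * r ^ badCount S u`. -/
lemma wordSum_gibbs (hinv : IsShiftInvariant μ) {g : List I → ℝ} {r : ℝ} (hg : ∀ u, 0 < g u)
    (hr : 0 < r) (S : Set (List I)) (n : ℕ)
    (hq : wordSum n (fun u => g u * r ^ badCount S u) ≤ 1) :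
    -wordSum n (fun u => μ.real (cyl u) * Real.log (μ.real (cyl u))) +
        wordSum n (fun u => μ.real (cyl u) * Real.log (g u)) ≤
      -Real.log r * wordSum n (fun u => μ.real (cyl u) * badCount S u) := by
  have key : wordSum n (fun u => (-1) * (μ.real (cyl u) * Real.log (μ.real (cyl u))) +
      (μ.real (cyl u) * Real.log (g u) +
        Real.log r * (μ.real (cyl u) * badCount S u))) ≤
      wordSum n (fun u => g u * r ^ badCount S u + (-1) * μ.real (cyl u)) := by
    refine wordSum_mono fun u _ => ?_
    have hm : 0 ≤ μ.real (cyl u) := measureReal_nonneg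
    have hqu : 0 < g u * r ^ badCount S u := mul_pos (hg u) (pow_pos hr _)
    rcases hm.eq_or_lt with hm0 | hm0
    · rw [← hm0]
      simpa using hqu.le
    · have hlog := Real.log_le_sub_one_of_pos (div_pos hqu hm0)
      rw [Real.log_div hqu.ne' hm0.ne', Real.log_mul (hg u).ne' (pow_pos hr _).ne',
        Real.log_pow] at hlog
      have h2 := mul_le_mul_of_nonneg_left hlog hm
      rw [mul_sub (μ.real (cyl u)) (_ / _), mul_div_cancel₀ _ hm0.ne'] at h2
      linarith
  rw [wordSum_add, wordSum_add, wordSum_add, wordSum_mul_left, wordSum_mul_left,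
    wordSum_mul_left, wordSum_measureReal_cyl μ hinv] at key
  linarith

end measure

section dimension

variable {I : Type*} (C : CylFun I)

lemma Gpre_mono_set (s : ℝ) (h : ℕ → I) (n : ℕ) {A B : Set (ℕ → I)} (hAB : A ⊆ B) :
    Gpre C s h n A ≤ Gpre C s h n B :=
  le_iInf₂ fun c hc => le_iInf fun hn => iInf₂_le_of_le c (hAB.trans hc) (iInf_le _ hn)

lemma Gmeas_mono_set (s : ℝ) (h : ℕ → I) {A B : Set (ℕ → I)} (hAB : A ⊆ B) :
    Gmeas C s h A ≤ Gmeas C s h B :=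
  iSup_mono fun n => Gpre_mono_set C s h n hAB

lemma eqDim_nonneg (h : ℕ → I) (A : Set (ℕ → I)) : 0 ≤ eqDim C h A :=
  Real.sInf_nonneg fun _ hs => hs.1

open Classical in
/-- The weight `ψ` extended by `1` to the empty word. -/
noncomputable def CylFun.weight (s : ℝ) (h : ℕ → I) (u : List I) : ℝ :=
  if u = [] then 1 else C.ψ s u h

lemma CylFun.weight_pos {s : ℝ} (hs : 0 ≤ s) (h : ℕ → I) (u : List I) : 0 < C.weight s h u := by
  unfold CylFun.weight
  split_ifs with hu
  exacts [one_pos, C.pos s hs u hu h]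

lemma CylFun.weight_append_le {s : ℝ} (hs : 0 ≤ s) (h : ℕ → I) (u v : List I) :
    C.weight s h (u ++ v) ≤ C.K s * C.weight s h u * C.weight s h v := by
  have hK := C.one_le_K s hs
  by_cases hu : u = []
  · subst hu
    have hv := C.weight_pos hs h v
    have h1 : C.weight s h ([] : List I) = 1 := by simp [CylFun.weight]
    rw [h1, List.nil_append]
    nlinarith
  by_cases hv : v = []
  · subst hv
    have hu := C.weight_pos hs h u
    have h1 : C.weight s h ([] : List I) = 1 := by simp [CylFun.weight]
    rw [h1, List.append_nil]
    nlinarith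
  simp only [CylFun.weight, List.append_eq_nil_iff, hu, hv, and_self, if_false]
  have hsub := C.subchain s hs (u ++ v) u.length (List.length_pos_of_ne_nil hu)
    (by simpa using List.length_pos_of_ne_nil hv) h
  rw [List.take_left, List.drop_left] at hsub
  exact hsub.trans (mul_le_mul_of_nonneg_right (C.bvp s hs u hu _ h) (C.pos s hs v hv h).le)

lemma exists_finset_of_Gmeas_eq_zero [MeasurableSpace I] [DiscreteMeasurableSpace I]
    {s : ℝ} (hs : 0 ≤ s) {h : ℕ → I} (μ : Measure (ℕ → I)) [IsProbabilityMeasure μ]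
    {A : Set (ℕ → I)} (hA : μ A = 1) (hG : Gmeas C s h A = 0) {δ ε : ℝ} (hδ : 0 < δ)
    (hε : 0 < ε) :
    ∃ S : Finset (List I), (∀ w ∈ S, w ≠ []) ∧ ∑ w ∈ S, C.ψ s w h ≤ δ ∧
      μ.real (⋃ w ∈ S, cyl w)ᶜ ≤ ε := by
  classical
  have hG1 : Gpre C s h 1 A < ENNReal.ofReal δ := by
    have : Gpre C s h 1 A ≤ 0 := hG ▸ le_iSup (fun n => Gpre C s h n A) 1
    exact this.trans_lt (by simpa using hδ)
  simp only [Gpre, iInf_lt_iff] at hG1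
  obtain ⟨c, hcov, hlen, hsum⟩ := hG1
  have hne : ∀ j, c j ≠ [] := fun j => List.ne_nil_of_length_pos (hlen j)
  have hU : μ (⋃ j, cyl (c j)) = 1 :=
    le_antisymm prob_le_one (hA ▸ measure_mono hcov)
  have htend := tendsto_measure_iUnion_accumulate (μ := μ) (f := fun j => cyl (c j))
  rw [hU] at htend
  have hlt : ENNReal.ofReal (1 - ε) < 1 := by
    rw [ENNReal.ofReal_lt_one]; linarith
  obtain ⟨J, hJ⟩ := (htend.eventually (lt_mem_nhds hlt)).exists
  refine ⟨(Finset.range (J + 1)).image c, ?_, ?_, ?_⟩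
  · intro w hw
    obtain ⟨j, -, rfl⟩ := Finset.mem_image.1 hw
    exact hne j
  · have hpos : ∀ j, 0 ≤ C.ψ s (c j) h := fun j => (C.pos s hs _ (hne j) h).le
    refine (Finset.sum_image_le_of_nonneg (f := fun w => C.ψ s w h) fun w hw => ?_).trans ?_
    · obtain ⟨j, -, rfl⟩ := Finset.mem_image.1 hw
      exact hpos j
    · have h1 := (ENNReal.sum_le_tsum (f := fun j => ENNReal.ofReal (C.ψ s (c j) h))
        (Finset.range (J + 1))).trans hsum.le
      rw [← ENNReal.ofReal_sum_of_nonneg fun j _ => hpos j] at h1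
      exact (ENNReal.ofReal_le_ofReal_iff hδ.le).1 h1
  · have hset : (⋃ w ∈ (Finset.range (J + 1)).image c, cyl w) =
        Set.accumulate (fun j => cyl (c j)) J := by
      ext x
      simp [Set.accumulate]
    rw [measureReal_compl (Finset.measurableSet_biUnion _ fun w _ => measurableSet_cyl w), hset,
      probReal_univ]
    have h2 : 1 - ε ≤ μ.real (Set.accumulate (fun j => cyl (c j)) J) :=
      (ENNReal.ofReal_le_iff_le_toReal (measure_ne_top _ _)).1 hJ.le
    linarith

variable [Fintype I]

/-- If `G^s` vanishes on a set of full measure, the free energy at parameter `s` is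
asymptotically nonpositive. -/
lemma eventually_entSeq_add_enSeq_le [MeasurableSpace I] [DiscreteMeasurableSpace I]
    {s : ℝ} (hs : 0 ≤ s) {h : ℕ → I} (μ : Measure (ℕ → I)) [IsProbabilityMeasure μ]
    (hinv : IsShiftInvariant μ) {A : Set (ℕ → I)} (hA : μ A = 1) (hG : Gmeas C s h A = 0)
    {η : ℝ} (hη : 0 < η) :
    ∀ᶠ n in atTop, entSeq μ n + enSeq μ C s h n ≤ η := by
  have hK := C.one_le_K s hs
  have hK0 : 0 < C.K s := by linarith
  set M : ℝ := ∑ a : I, C.K s * C.weight s h [a] with hM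
  have hM0 : 0 ≤ M :=
    Finset.sum_nonneg fun a _ => (mul_pos hK0 (C.weight_pos hs h _)).le
  set R : ℝ := 2 * M + 1 with hR
  have hR1 : 1 ≤ R := by linarith
  have hR0 : 0 < R := by linarith
  have hlogR : 0 ≤ Real.log R := Real.log_nonneg hR1
  set ε : ℝ := η / (2 * (Real.log R + 1)) with hε
  have hε0 : 0 < ε := by positivity
  obtain ⟨S, hSne, hSsum, hSμ⟩ := exists_finset_of_Gmeas_eq_zero C hs μ hA hG
    (δ := 1 / (2 * C.K s)) (by positivity) hε0
  have hSsum' : ∑ w ∈ S, C.K s * C.weight s h w ≤ 1 / 2 := by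
    rw [← Finset.mul_sum]
    have : ∑ w ∈ S, C.weight s h w = ∑ w ∈ S, C.ψ s w h :=
      Finset.sum_congr rfl fun w hw => by simp [CylFun.weight, hSne w hw]
    rw [this]
    calc C.K s * ∑ w ∈ S, C.ψ s w h ≤ C.K s * (1 / (2 * C.K s)) :=
          mul_le_mul_of_nonneg_left hSsum hK0.le
      _ = 1 / 2 := by field_simp
  have hletter : ∑ a : I, C.K s * C.weight s h [a] * R⁻¹ ≤ 1 / 2 := by
    rw [← Finset.sum_mul, ← hM, ← div_eq_mul_inv, div_le_iff₀ hR0]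
    linarith
  set L := S.sup List.length with hL
  have hLS : ∀ w ∈ S, w.length ≤ L := fun w hw => Finset.le_sup (f := List.length) hw
  have hbound : ∀ n : ℕ, 1 ≤ n →
      entSeq μ n + enSeq μ C s h n ≤ Real.log R * (ε + L * (n : ℝ)⁻¹) := by
    intro n hn
    have hn0 : (0 : ℝ) < n := by exact_mod_cast hn
    have hkraft := wordSum_discounted_le_one (fun u => (C.weight_pos hs h u).le)
      (by simp [CylFun.weight]) (C.weight_append_le hs h) hK0.le (inv_nonneg.2 hR0.le)
      (inv_le_one_of_one_le₀ hR1) S hSne hSsum' hletter n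
    have hgibbs := wordSum_gibbs μ hinv (C.weight_pos hs h) (inv_pos.2 hR0) _ n hkraft
    have hcount := wordSum_badCount_le μ hinv S hLS n
    rw [Real.log_inv, neg_neg] at hgibbs
    have hcount' : wordSum n (fun u => μ.real (cyl u) * badCount (S : Set (List I)) u) ≤
        n * ε + L := hcount.trans (by gcongr)
    have hfin := hgibbs.trans (mul_le_mul_of_nonneg_left hcount' hlogR)
    have hen : enSeq μ C s h n =
        (n : ℝ)⁻¹ * wordSum n (fun u => μ.real (cyl u) * Real.log (C.weight s h u)) := by
      rw [enSeq]
      congr 1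
      refine Finset.sum_congr rfl fun f _ => ?_
      have : List.ofFn f ≠ [] := List.ne_nil_of_length_pos (by simp; omega)
      simp [CylFun.weight, this, Measure.real]
    have hent : entSeq μ n =
        -((n : ℝ)⁻¹ * wordSum n (fun u => μ.real (cyl u) * Real.log (μ.real (cyl u)))) := rfl
    rw [hen, hent]
    calc _ = (n : ℝ)⁻¹ * (-wordSum n (fun u => μ.real (cyl u) * Real.log (μ.real (cyl u))) +
          wordSum n (fun u => μ.real (cyl u) * Real.log (C.weight s h u))) := by ring
      _ ≤ (n : ℝ)⁻¹ * (Real.log R * (n * ε + L)) :=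
          mul_le_mul_of_nonneg_left hfin (inv_nonneg.2 hn0.le)
      _ = Real.log R * (ε + L * (n : ℝ)⁻¹) := by field_simp
  have hlim : Tendsto (fun n : ℕ => Real.log R * (ε + L * (n : ℝ)⁻¹)) atTop
      (𝓝 (Real.log R * (ε + L * 0))) :=
    ((tendsto_inv_atTop_nhds_zero_nat.const_mul _).const_add _).const_mul _
  have hlt : Real.log R * (ε + L * 0) < η := by
    rw [mul_zero, add_zero, hε, mul_div_assoc', div_lt_iff₀ (by positivity)]
    nlinarith
  filter_upwards [hlim.eventually (gt_mem_nhds hlt), eventually_ge_atTop 1] with n hn hn1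
  exact (hbound n hn1).trans hn.le

lemma enSeq_add_le [MeasurableSpace I] [DiscreteMeasurableSpace I] {s t : ℝ} (hs : 0 ≤ s)
    (hst : s ≤ t) (h : ℕ → I) (μ : Measure (ℕ → I)) [IsProbabilityMeasure μ]
    (hinv : IsShiftInvariant μ) {n : ℕ} (hn : 1 ≤ n) :
    enSeq μ C t h n + (t - s) * -Real.log C.shi ≤ enSeq μ C s h n := by
  have hn0 : (0 : ℝ) < n := by exact_mod_cast hn
  have key : wordSum n (fun u => μ.real (cyl u) * Real.log (C.ψ t u h) +
      ((t - s) * n * -Real.log C.shi) * μ.real (cyl u)) ≤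
      wordSum n (fun u => μ.real (cyl u) * Real.log (C.ψ s u h)) := by
    refine wordSum_mono fun u hu => ?_
    have hune : u ≠ [] := List.ne_nil_of_length_pos (by omega)
    have hp := C.param_le s hs (t - s) (sub_nonneg.2 hst) u hune h
    rw [add_sub_cancel, hu] at hp
    have hlog := Real.log_le_log (C.pos t (hs.trans hst) u hune h) hp
    rw [Real.log_mul (C.pos s hs u hune h).ne' (Real.rpow_pos_of_pos C.shi_pos _).ne',
      Real.log_rpow C.shi_pos] at hlog
    have := mul_le_mul_of_nonneg_left hlog (measureReal_nonneg (μ := μ) (s := cyl u))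
    linarith
  rw [wordSum_add, wordSum_mul_left, wordSum_measureReal_cyl μ hinv] at key
  have h1 := mul_le_mul_of_nonneg_left key (inv_nonneg.2 hn0.le)
  have h2 : (n : ℝ)⁻¹ * (wordSum n (fun u => μ.real (cyl u) * Real.log (C.ψ t u h)) +
      (t - s) * n * -Real.log C.shi * 1) = enSeq μ C t h n + (t - s) * -Real.log C.shi := by
    rw [mul_add]
    congr 1
    field_simp
  rw [h2] at h1
  exact h1

/-- Above the zero of the pressure the measure `G^s` of the whole space vanishes. -/
lemma Gmeas_univ_eq_zero [Nonempty I] {s t : ℝ} (ht : 0 ≤ t) (hts : t < s) {h : ℕ → I}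
    (hP : Tendsto (presSeq C t h) atTop (𝓝 0)) : Gmeas C s h Set.univ = 0 := by
  set η : ℝ := (s - t) * -Real.log C.shi / 2 with hη
  have hη0 : 0 < η := by
    have := Real.log_neg C.shi_pos C.shi_lt_one
    have h2 : 0 < s - t := sub_pos.2 hts
    have h3 : 0 < -Real.log C.shi := by linarith
    positivity
  set ρ : ℝ := Real.exp (-η) with hρ
  have hρ0 : 0 < ρ := Real.exp_pos _
  have hρ1 : ρ < 1 := by rw [hρ, Real.exp_lt_one_iff]; linarith
  have hlevel : ∀ᶠ n : ℕ in atTop, wordSum n (fun u => C.ψ s u h) ≤ ρ ^ n := by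
    filter_upwards [hP.eventually (gt_mem_nhds hη0), eventually_ge_atTop 1] with n hn hn1
    have hn0 : (0 : ℝ) < n := by exact_mod_cast hn1
    have hne : ∀ u : List I, u.length = n → u ≠ [] := fun u hu =>
      List.ne_nil_of_length_pos (by omega)
    have hpos : 0 < wordSum n (fun u => C.ψ t u h) :=
      Finset.sum_pos (fun f _ => C.pos t ht _ (hne _ (by simp)) h) Finset.univ_nonempty
    have hlog : Real.log (wordSum n (fun u => C.ψ t u h)) ≤ n * η := by
      have : (n : ℝ)⁻¹ * Real.log (wordSum n (fun u => C.ψ t u h)) < η := hn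
      rw [inv_mul_lt_iff₀ hn0] at this
      exact this.le
    have hsum : wordSum n (fun u => C.ψ t u h) ≤ Real.exp (n * η) :=
      (Real.log_le_iff_le_exp hpos).1 hlog
    calc wordSum n (fun u => C.ψ s u h)
        ≤ wordSum n (fun u => C.shi ^ ((s - t) * (n : ℝ)) * C.ψ t u h) := by
          refine wordSum_mono fun u hu => ?_
          have hp := C.param_le t ht (s - t) (sub_nonneg.2 hts.le) u (hne u hu) h
          rw [add_sub_cancel, hu] at hp
          linarith
      _ = C.shi ^ ((s - t) * (n : ℝ)) * wordSum n (fun u => C.ψ t u h) := wordSum_mul_left _ _ _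
      _ ≤ C.shi ^ ((s - t) * (n : ℝ)) * Real.exp (n * η) :=
          mul_le_mul_of_nonneg_left hsum (Real.rpow_nonneg C.shi_pos.le _)
      _ = ρ ^ n := by
          rw [Real.rpow_def_of_pos C.shi_pos, ← Real.exp_add, hρ, ← Real.exp_nat_mul]
          congr 1
          rw [hη]
          ring
  obtain ⟨N₀, hN₀⟩ := eventually_atTop.1 hlevel
  have hcover : ∀ n N : ℕ, n ≤ N → 1 ≤ N → N₀ ≤ N →
      Gpre C s h n Set.univ ≤ ENNReal.ofReal (ρ ^ N * (1 - ρ)⁻¹) := by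
    intro n N hnN hN1 hN
    have : Infinite (Σ m : ℕ, (Fin (N + m) → I)) := inferInstance
    obtain ⟨_⟩ := nonempty_denumerable (Σ m : ℕ, (Fin (N + m) → I))
    let e := (Denumerable.eqv (Σ m : ℕ, (Fin (N + m) → I))).symm
    refine iInf₂_le_of_le (fun j => List.ofFn (e j).2) ?_ (iInf_le_of_le (fun j => ?_) ?_)
    · intro x _
      refine Set.mem_iUnion.2 ⟨e.symm ⟨0, fun k => x k⟩, ?_⟩
      beta_reduce
      rw [Equiv.apply_symm_apply]
      exact mem_cyl_pref x N
    · simp only [List.length_ofFn]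
      omega
    · have hnn : ∀ (m : ℕ) (f : Fin (N + m) → I), 0 ≤ C.ψ s (List.ofFn f) h := fun m f =>
        (C.pos s (ht.trans hts.le) _ (List.ne_nil_of_length_pos (by simp; omega)) h).le
      rw [e.tsum_eq (fun p : Σ m : ℕ, (Fin (N + m) → I) =>
        ENNReal.ofReal (C.ψ s (List.ofFn p.2) h)),
        ENNReal.tsum_sigma (fun (m : ℕ) (f : Fin (N + m) → I) =>
          ENNReal.ofReal (C.ψ s (List.ofFn f) h))]
      calc ∑' (m : ℕ) (f : Fin (N + m) → I), ENNReal.ofReal (C.ψ s (List.ofFn f) h)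
          ≤ ∑' m : ℕ, ENNReal.ofReal (ρ ^ N * ρ ^ m) := by
            refine ENNReal.tsum_le_tsum fun m => ?_
            rw [tsum_fintype, ← ENNReal.ofReal_sum_of_nonneg fun f _ => hnn m f, ← pow_add]
            exact ENNReal.ofReal_le_ofReal (hN₀ (N + m) (by omega))
        _ = ENNReal.ofReal (ρ ^ N * (1 - ρ)⁻¹) := by
            rw [← ENNReal.ofReal_tsum_of_nonneg (fun m => by positivity)
              ((summable_geometric_of_lt_one hρ0.le hρ1).mul_left _), tsum_mul_left,
              tsum_geometric_of_lt_one hρ0.le hρ1]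
  have hlim : Tendsto (fun N : ℕ => ENNReal.ofReal (ρ ^ N * (1 - ρ)⁻¹)) atTop (𝓝 0) := by
    have := (tendsto_pow_atTop_nhds_zero_of_lt_one hρ0.le hρ1).mul_const (1 - ρ)⁻¹
    rw [zero_mul] at this
    simpa using ENNReal.tendsto_ofReal this
  refine le_antisymm (iSup_le fun n => ge_of_tendsto hlim ?_) bot_le
  filter_upwards [eventually_ge_atTop n, eventually_ge_atTop 1, eventually_ge_atTop N₀]
    with N h1 h2 h3 using hcover n N h1 h2 h3

end dimension

/-- If `P(t) = 0` and `μ` is an ergodic `t`-equilibrium measure, then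
`dim_ψ(μ) = inf { dim_ψ(A) : A Borel, μ(A) = 1 } = t`. -/
theorem eqDim_of_equilibrium_measure {I : Type*} [Fintype I] [MeasurableSpace I]
    [DiscreteMeasurableSpace I] (hcard : 2 ≤ Fintype.card I)
    (C : CylFun I) (t : ℝ) (ht : 0 ≤ t) (h : ℕ → I)
    (μ : Measure (ℕ → I)) [IsProbabilityMeasure μ]
    (hinv : IsShiftInvariant μ) (herg : IsShiftErgodic μ) (H E : ℝ)
    (hP : Tendsto (presSeq C t h) atTop (𝓝 0))
    (hH : Tendsto (entSeq μ) atTop (𝓝 H))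
    (hE : Tendsto (enSeq μ C t h) atTop (𝓝 E))
    (hequil : (0 : ℝ) = H + E) :
    sInf {s : ℝ | ∃ A : Set (ℕ → I), MeasurableSet A ∧ μ A = 1 ∧ eqDim C h A = s} = t := by
  have hI : Nonempty I := ⟨h 0⟩
  have hzero : ∀ A : Set (ℕ → I), ∀ s, t < s → Gmeas C s h A = 0 := fun A s hs =>
    le_antisymm ((Gmeas_mono_set C s h (Set.subset_univ A)).trans
      (Gmeas_univ_eq_zero C ht hs hP).le) bot_le
  have hupper : eqDim C h Set.univ ≤ t := by
    refine le_of_forall_gt_imp_ge_of_dense fun s hs => ?_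
    exact csInf_le ⟨0, fun _ hr => hr.1⟩ ⟨ht.trans hs.le, hzero _ s hs⟩
  have hlower : ∀ A : Set (ℕ → I), μ A = 1 → t ≤ eqDim C h A := by
    intro A hA
    refine le_csInf ⟨t + 1, by linarith, hzero A _ (by linarith)⟩ ?_
    rintro s ⟨hs, hG⟩
    by_contra! hst
    set c : ℝ := (t - s) * -Real.log C.shi with hc
    have hc0 : 0 < c :=
      mul_pos (sub_pos.2 hst) (neg_pos.2 (Real.log_neg C.shi_pos C.shi_lt_one))
    have hsum : Tendsto (fun n => entSeq μ n + enSeq μ C t h n) atTop (𝓝 0) := by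
      rw [hequil]
      exact hH.add hE
    have hev := hsum.eventually (lt_mem_nhds (show -(c / 2) < 0 by linarith))
    obtain ⟨n, h1, h2, h3⟩ := (hev.and ((eventually_entSeq_add_enSeq_le C hs μ hinv hA hG
      (half_pos hc0)).and (eventually_ge_atTop 1))).exists
    have h4 := enSeq_add_le C hs hst.le h μ hinv h3
    linarith
  refine le_antisymm ?_ ?_
  · refine le_trans (csInf_le ⟨0, ?_⟩ ⟨Set.univ, MeasurableSet.univ, measure_univ, rfl⟩) hupper
    rintro _ ⟨A, -, -, rfl⟩
    exact eqDim_nonneg C h A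
  · refine le_csInf ⟨_, Set.univ, MeasurableSet.univ, measure_univ, rfl⟩ ?_
    rintro _ ⟨A, -, hA, rfl⟩
    exact hlower A hA
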